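/- Let N, M be positive integers with M a proper divisor of N, and let λ_0, …, λ_{N−1} ∈ ℂ be pairwise distinct. Write x ≡ y for x ≡ y (mod M). Define a tensor r with components r^{ab}_{cd} ∈ ℂ (indices in {0,…,N−1}) by: (i) r^{ab}_{cd} = 0 if a ≢ d or b ≢ c; (ii) for a ≠ e with e ≡ a: r^{aa}_{ea} = 1/(λ_a − λ_e) and r^{aa}_{ae} = −1/(λ_a − λ_e); (iii) r^{aa}_{cd} = 0 for every other pair (c,d), in particular r^{aa}_{aa} = 0; (iv) for a ≠ b: r^{ab}_{ba} = (1/(λ_a − λ_b)) · ( [∏_{b'≡b, b'≠b}(λ_a − λ_{b'}) · ∏_{a'≡a, a'≠a}(λ_b − λ_{a'})] / [∏_{a'≡a, a'≠a}(λ_a − λ_{a'}) · ∏_{b'≡b, b'≠b}(λ_b − λ_{b'})] − 1 ); (v) in all remaining cases (a ≠ b, a ≡ d, b ≡ c, (c,d) ≠ (b,a)): r^{ab}_{cd} = (1/(λ_a − λ_b)) · [∏_{c'≡c, c'≠c}(λ_a − λ_{c'}) · ∏_{d'≡d, d'≠d}(λ_b − λ_{d'})] / [∏_{a'≡a, a'≠a}(λ_a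 − λ_{a'}) · ∏_{b'≡b, b'≠b}(λ_b − λ_{b'})]. Then r is a skew-symmetric solution of the associative Yang–Baxter equation: r^{γε}_{αβ} = −r^{εγ}_{βα} for all indices, and Σ_σ ( r^{λσ}_{αβ} r^{μν}_{στ} + r^{μσ}_{βτ} r^{νλ}_{σα} + r^{νσ}_{τα} r^{λμ}_{σβ} ) = 0 for all indices α, β, τ, λ, μ, ν. -/

import Mathlib

open BigOperators Finset

/-- A tensor `r` (with `r a b c d` denoting the component `r^{ab}_{cd}`) is a skew-symmetric
solution of the associative Yang–Baxter equation. -/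
def IsAYBESolution (N : ℕ) (r : Fin N → Fin N → Fin N → Fin N → ℂ) : Prop :=
  (∀ γ ε α β : Fin N, r γ ε α β = - r ε γ β α) ∧
  (∀ α β τ lam mu nu : Fin N,
    ∑ σ : Fin N,
      (r lam σ α β * r mu nu σ τ + r mu σ β τ * r nu lam σ α + r nu σ τ α * r lam mu σ β)
      = 0)

/-- `Pprod N M lam x y = ∏_{y' ≡ y (mod M), y' ≠ y} (λ_x − λ_{y'})`. -/
noncomputable def Pprod (N M : ℕ) (lam : Fin N → ℂ) (x y : Fin N) : ℂ :=
  ∏ y' ∈ Finset.univ.filter (fun y' : Fin N => (y' : ℕ) % M = (y : ℕ) % M ∧ y' ≠ y),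
    (lam x - lam y')

/-- The tensor (all congruences mod `M`, `r a b c d` denoting `r^{ab}_{cd}`):
`r^{ab}_{cd} = 0` if `a ≢ d` or `b ≢ c`; for `a = b`: `r^{aa}_{ea} = 1/(λ_a − λ_e)` and
`r^{aa}_{ae} = −1/(λ_a − λ_e)` for `e ≠ a` (`e ≡ a`), and `0` for every other pair `(c,d)`;
for `a ≠ b`: `r^{ab}_{ba} = (1/(λ_a−λ_b))·(P_a(b)P_b(a)/(P_a(a)P_b(b)) − 1)` and otherwise
`r^{ab}_{cd} = (1/(λ_a−λ_b))·P_a(c)P_b(d)/(P_a(a)P_b(b))`, where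
`P_x(y) = ∏_{y'≡y, y'≠y}(λ_x − λ_{y'})`. -/
noncomputable def rGen (N M : ℕ) (lam : Fin N → ℂ) (a b c d : Fin N) : ℂ :=
  if (a : ℕ) % M ≠ (d : ℕ) % M ∨ (b : ℕ) % M ≠ (c : ℕ) % M then 0
  else if a = b then
    (if d = a ∧ c ≠ a then 1 / (lam a - lam c)
     else if c = a ∧ d ≠ a then -(1 / (lam a - lam d))
     else 0)
  else if c = b ∧ d = a then
    (1 / (lam a - lam b)) *
      ((Pprod N M lam a b * Pprod N M lam b a) / (Pprod N M lam a a * Pprod N M lam b b) - 1)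
  else
    (1 / (lam a - lam b)) *
      ((Pprod N M lam a c * Pprod N M lam b d) / (Pprod N M lam a a * Pprod N M lam b b))

open Polynomial in
/-- The Bezoutian quotient `(f(x) g(Y) − f(Y) g(x)) / (x − Y)`, as a polynomial in `Y`. -/
noncomputable def bezoutQuot {R : Type*} [CommRing R] (f g : R[X]) (x : R) : R[X] :=
  C (g.eval x) * (f /ₘ (X - C x)) - C (f.eval x) * (g /ₘ (X - C x))

namespace bezoutQuot

open Polynomial

variable {R : Type*} [CommRing R]

lemma sub_mul_eval (f g : R[X]) (x y : R) :
    (x - y) * (bezoutQuot f g x).eval y = f.eval x * g.eval y - f.eval y * g.eval x := by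
  have hf := congrArg (eval y) (X_sub_C_mul_divByMonic_eq_sub_modByMonic f x)
  have hg := congrArg (eval y) (X_sub_C_mul_divByMonic_eq_sub_modByMonic g x)
  simp only [modByMonic_X_sub_C_eq_C_eval, eval_mul, eval_sub, eval_X, eval_C] at hf hg
  simp only [bezoutQuot, eval_sub, eval_mul, eval_C]
  linear_combination f.eval x * hg - g.eval x * hf

lemma swap (f g : R[X]) (x : R) : bezoutQuot f g x = -bezoutQuot g f x := by
  simp [bezoutQuot]

lemma eval_swap [IsDomain R] (f g : R[X]) (x y : R) :
    (bezoutQuot f g x).eval y = -(bezoutQuot g f y).eval x := by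
  rcases eq_or_ne x y with rfl | h
  · rw [swap, eval_neg]
  · apply mul_left_cancel₀ (sub_ne_zero.mpr h)
    linear_combination sub_mul_eval f g x y - sub_mul_eval g f y x

lemma map {S : Type*} [CommRing S] (φ : R →+* S) (f g : R[X]) (x : R) :
    (bezoutQuot f g x).map φ = bezoutQuot (f.map φ) (g.map φ) (φ x) := by
  simp [bezoutQuot, map_divByMonic φ (monic_X_sub_C x), eval_map_apply]

lemma _root_.Polynomial.sum_smul_divByMonic_X_sub_C {ι : Type*} (s : Finset ι) (c : ι → R)
    (p : ι → R[X]) (x : R) :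
    (∑ i ∈ s, c i • p i) /ₘ (X - C x) = ∑ i ∈ s, c i • (p i /ₘ (X - C x)) := by
  nontriviality R
  refine (div_modByMonic_unique _ (∑ i ∈ s, c i • (p i %ₘ (X - C x))) (monic_X_sub_C x)
    ⟨?_, ?_⟩).1
  · rw [Finset.mul_sum, ← Finset.sum_add_distrib]
    refine Finset.sum_congr rfl fun i _ => ?_
    rw [mul_smul_comm, ← smul_add, modByMonic_add_div]
  · refine (degree_sum_le _ _).trans_lt ((Finset.sup_lt_iff ?_).mpr fun i _ => ?_)
    · simp
    · exact (degree_smul_le _ _).trans_lt (degree_modByMonic_lt _ (monic_X_sub_C x))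

lemma sum_smul_left {ι : Type*} (s : Finset ι) (c : ι → R) (p : ι → R[X]) (g : R[X]) (x : R) :
    bezoutQuot (∑ i ∈ s, c i • p i) g x = ∑ i ∈ s, c i • bezoutQuot (p i) g x := by
  simp only [bezoutQuot, sum_smul_divByMonic_X_sub_C, eval_finsetSum, eval_smul, smul_sub,
    Finset.sum_sub_distrib, Finset.mul_sum, map_sum, Finset.sum_mul, smul_eq_mul, C_mul]
  simp only [smul_eq_C_mul]
  refine congrArg₂ (· - ·) (Finset.sum_congr rfl fun i _ => ?_)
    (Finset.sum_congr rfl fun i _ => ?_)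
  · ring
  · ring

lemma degree_lt {f g : R[X]} {n : ℕ} (hf : f.degree < n) (hg : g.degree < n) (x : R) :
    (bezoutQuot f g x).degree < n := by
  have key : ∀ (a : R) {q : R[X]}, q.degree < n → (C a * (q /ₘ (X - C x))).degree < n := by
    intro a q hq
    rw [← smul_eq_C_mul]
    exact (degree_smul_le _ _).trans_lt ((degree_divByMonic_le _ _).trans_lt hq)
  exact (degree_sub_le _ _).trans_lt (max_lt (key _ hf) (key _ hg))

lemma cyclic_sum_of_ne [IsDomain R] (f g h : R[X]) {x y z : R}
    (hxy : x ≠ y) (hyz : y ≠ z) (hzx : z ≠ x) :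
    (bezoutQuot (bezoutQuot f g x) h y).eval z + (bezoutQuot (bezoutQuot g h y) f z).eval x
      + (bezoutQuot (bezoutQuot h f z) g x).eval y = 0 := by
  apply mul_left_cancel₀ (mul_ne_zero (mul_ne_zero (sub_ne_zero.mpr hxy) (sub_ne_zero.mpr hyz))
    (sub_ne_zero.mpr hzx))
  linear_combination
    (x - y) * (z - x) * sub_mul_eval (bezoutQuot f g x) h y z
    + (x - y) * (y - z) * sub_mul_eval (bezoutQuot g h y) f z x
    + (y - z) * (z - x) * sub_mul_eval (bezoutQuot h f z) g x y
    + (z - x) * h.eval z * sub_mul_eval f g x y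
    + (x - y) * h.eval y * sub_mul_eval f g x z
    + (x - y) * f.eval x * sub_mul_eval g h y z
    + (y - z) * f.eval z * sub_mul_eval g h y x
    + (y - z) * g.eval y * sub_mul_eval h f z x
    + (z - x) * g.eval x * sub_mul_eval h f z y

/-- The associative Yang–Baxter identity for Bezoutian quotients. -/
lemma cyclic_sum [IsDomain R] (f g h : R[X]) (x y z : R) :
    (bezoutQuot (bezoutQuot f g x) h y).eval z + (bezoutQuot (bezoutQuot g h y) f z).eval x
      + (bezoutQuot (bezoutQuot h f z) g x).eval y = 0 := by
  -- specialise the identity at three independent variables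
  let v : Fin 3 → R := ![x, y, z]
  let φ : MvPolynomial (Fin 3) R →+* R := MvPolynomial.eval v
  have hX : ∀ {i j : Fin 3}, i ≠ j → (MvPolynomial.X i : MvPolynomial (Fin 3) R) ≠
      MvPolynomial.X j := fun hij h => hij (MvPolynomial.X_injective h)
  have hφ : ∀ q : R[X], (q.map MvPolynomial.C).map φ = q := by
    intro q
    have hcomp : φ.comp MvPolynomial.C = RingHom.id R := by
      ext r; simp [φ]
    rw [Polynomial.map_map, hcomp, Polynomial.map_id]
  have hv : ∀ i, φ (MvPolynomial.X i) = v i := fun i => by simp [φ]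
  have key := congrArg φ (cyclic_sum_of_ne (f.map MvPolynomial.C) (g.map MvPolynomial.C)
    (h.map MvPolynomial.C) (hX (show (0 : Fin 3) ≠ 1 by decide))
    (hX (show (1 : Fin 3) ≠ 2 by decide)) (hX (show (2 : Fin 3) ≠ 0 by decide)))
  simpa only [map_add, map_zero, ← eval_map_apply, map, hφ, hv, v, Matrix.cons_val] using key

end bezoutQuot

section

open Polynomial

/-- The indices congruent to `c` modulo `M`. -/
def congrClass (N M : ℕ) (c : Fin N) : Finset (Fin N) :=
  Finset.univ.filter fun y => (y : ℕ) % M = (c : ℕ) % M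

/-- The polynomial `∏_{y ≡ c, y ≠ c} (X − λ_y)`. -/
noncomputable def classPoly (N M : ℕ) (lam : Fin N → ℂ) (c : Fin N) : ℂ[X] :=
  ∏ y ∈ Finset.univ.filter (fun y : Fin N => (y : ℕ) % M = (c : ℕ) % M ∧ y ≠ c),
    (X - C (lam y))

variable {N M : ℕ} {lam : Fin N → ℂ}

lemma eval_classPoly (x c : Fin N) :
    (classPoly N M lam c).eval (lam x) = Pprod N M lam x c := by
  simp [classPoly, Pprod, eval_prod]

lemma Pprod_self_ne_zero (hlam : Function.Injective lam) (c : Fin N) :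
    Pprod N M lam c c ≠ 0 := by
  refine Finset.prod_ne_zero_iff.mpr fun y hy => sub_ne_zero.mpr fun h => ?_
  exact (Finset.mem_filter.mp hy).2.2 (hlam h).symm

lemma Pprod_eq_zero {x c : Fin N} (h : (x : ℕ) % M = (c : ℕ) % M) (hne : x ≠ c) :
    Pprod N M lam x c = 0 :=
  Finset.prod_eq_zero (Finset.mem_filter.mpr ⟨Finset.mem_univ x, h, hne⟩) (sub_self _)

lemma degree_classPoly_lt (c : Fin N) :
    (classPoly N M lam c).degree < (congrClass N M c).card := by
  rw [classPoly, degree_prod]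
  simp only [degree_X_sub_C, Finset.sum_const, nsmul_eq_mul, mul_one]
  refine Nat.cast_lt.mpr (Finset.card_lt_card ?_)
  refine Finset.ssubset_iff_subset_ne.mpr ⟨fun y hy => ?_, fun h => ?_⟩
  · simp only [congrClass, Finset.mem_filter] at hy ⊢
    exact ⟨hy.1, hy.2.1⟩
  · have hc : c ∈ congrClass N M c := by simp [congrClass]
    rw [← h] at hc
    exact (Finset.mem_filter.mp hc).2.2 rfl

lemma card_congrClass_le (hM : 0 < M) (hMN : M ∣ N) (b c : Fin N) :
    (congrClass N M b).card ≤ (congrClass N M c).card := by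
  have hbound : ∀ y : Fin N, M * ((y : ℕ) / M) + (c : ℕ) % M < N := by
    intro y
    obtain ⟨k, rfl⟩ := hMN
    have h1 : (y : ℕ) / M + 1 ≤ k := Nat.div_lt_of_lt_mul y.2
    have h2 := Nat.mod_lt (c : ℕ) hM
    calc M * ((y : ℕ) / M) + (c : ℕ) % M < M * ((y : ℕ) / M + 1) := by rw [mul_add]; omega
      _ ≤ M * k := Nat.mul_le_mul_left M h1
  refine Finset.card_le_card_of_injOn (fun y => ⟨M * ((y : ℕ) / M) + (c : ℕ) % M, hbound y⟩)
    (fun y _ => ?_) fun y hy z hz h => ?_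
  · simp [congrClass]
  · simp only [congrClass, Finset.coe_filter, Set.mem_ofPred_eq] at hy hz
    have h' : M * ((y : ℕ) / M) = M * ((z : ℕ) / M) := Nat.add_right_cancel (Fin.ext_iff.mp h)
    have h1 := Nat.div_add_mod (y : ℕ) M
    have h2 := Nat.div_add_mod (z : ℕ) M
    exact Fin.ext (by omega)

/-- Lagrange interpolation at the nodes of one congruence class. -/
lemma sum_smul_classPoly (hlam : Function.Injective lam) (c : Fin N) {F : ℂ[X]}
    (hF : F.degree < (congrClass N M c).card) :
    ∑ s ∈ congrClass N M c, (F.eval (lam s) / Pprod N M lam s s) • classPoly N M lam s = F := by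
  refine eq_of_degrees_lt_of_eval_index_eq (congrClass N M c) (hlam.injOn) ?_ hF ?_
  · refine (degree_sum_le _ _).trans_lt ((Finset.sup_lt_iff (WithBot.bot_lt_coe _)).mpr ?_)
    intro s hs
    have hcl : congrClass N M s = congrClass N M c := by
      simp only [congrClass, (Finset.mem_filter.mp hs).2]
    exact hcl ▸ (degree_smul_le _ _).trans_lt (degree_classPoly_lt s)
  · intro t ht
    rw [eval_finsetSum, Finset.sum_eq_single_of_mem t ht]
    · rw [eval_smul, eval_classPoly, smul_eq_mul, div_mul_cancel₀ _ (Pprod_self_ne_zero hlam t)]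
    · intro s hs hst
      rw [eval_smul, eval_classPoly, Pprod_eq_zero _ hst.symm, smul_zero]
      exact (Finset.mem_filter.mp ht).2.trans (Finset.mem_filter.mp hs).2.symm

lemma eval_bezoutQuot_classPoly_self (hlam : Function.Injective lam) {a c : Fin N}
    (h : (c : ℕ) % M = (a : ℕ) % M) (hne : c ≠ a) :
    (bezoutQuot (classPoly N M lam c) (classPoly N M lam a) (lam a)).eval (lam a)
      = Pprod N M lam a a * Pprod N M lam a a / (lam a - lam c) := by
  classical
  set s := Finset.univ.filter
    fun y : Fin N => (y : ℕ) % M = (a : ℕ) % M ∧ y ≠ a ∧ y ≠ c with hs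
  set q : ℂ[X] := ∏ y ∈ s, (X - C (lam y)) with hq
  have hc : classPoly N M lam c = (X - C (lam a)) * q := by
    rw [hq, ← Finset.prod_insert (s := s) (a := a) (f := fun y => X - C (lam y)) (by simp [hs]),
      classPoly]
    refine Finset.prod_congr ?_ fun _ _ => rfl
    ext y
    simp only [hs, Finset.mem_filter, Finset.mem_insert, Finset.mem_univ, true_and, h]
    grind
  have ha : classPoly N M lam a = (X - C (lam c)) * q := by
    rw [hq, ← Finset.prod_insert (s := s) (a := c) (f := fun y => X - C (lam y)) (by simp [hs]),
      classPoly]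
    refine Finset.prod_congr ?_ fun _ _ => rfl
    ext y
    simp only [hs, Finset.mem_filter, Finset.mem_insert, Finset.mem_univ, true_and]
    grind
  have hsub : lam a - lam c ≠ 0 := sub_ne_zero.mpr fun e => hne (hlam e).symm
  have hP : Pprod N M lam a a = (lam a - lam c) * q.eval (lam a) := by
    rw [← eval_classPoly, ha]; simp
  have hdiv : classPoly N M lam c /ₘ (X - C (lam a)) = q := by
    rw [hc, mul_divByMonic_cancel_left q (monic_X_sub_C _)]
  have hzero : (classPoly N M lam c).eval (lam a) = 0 := by rw [hc]; simp
  rw [bezoutQuot, hdiv, hzero, eval_classPoly, hP]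
  simp only [eval_sub, eval_mul, eval_C, zero_mul, sub_zero]
  field_simp

lemma rGen_eq (hlam : Function.Injective lam) (a b c d : Fin N) :
    rGen N M lam a b c d =
      if (a : ℕ) % M = (d : ℕ) % M ∧ (b : ℕ) % M = (c : ℕ) % M then
        (bezoutQuot (classPoly N M lam c) (classPoly N M lam d) (lam a)).eval (lam b)
          / (Pprod N M lam a a * Pprod N M lam b b)
      else 0 := by
  have hu := Pprod_self_ne_zero (M := M) hlam
  by_cases hcong : (a : ℕ) % M = (d : ℕ) % M ∧ (b : ℕ) % M = (c : ℕ) % M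
  swap
  · rw [rGen, if_pos (by tauto), if_neg hcong]
  obtain ⟨had, hbc⟩ := hcong
  rw [if_pos (show _ ∧ _ from ⟨had, hbc⟩), rGen, if_neg (by tauto)]
  rcases eq_or_ne a b with rfl | hab
  · rw [if_pos rfl]
    have hua := hu a
    by_cases hd : d = a
    · subst hd
      by_cases hc : c = d
      · subst hc; simp [bezoutQuot]
      · rw [if_pos ⟨rfl, hc⟩, eval_bezoutQuot_classPoly_self hlam hbc.symm hc]
        field_simp
    · by_cases hc : c = a
      · subst hc
        rw [if_neg (by tauto), if_pos ⟨rfl, hd⟩, bezoutQuot.swap, eval_neg,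
          eval_bezoutQuot_classPoly_self hlam had.symm hd]
        field_simp
      · rw [if_neg (by tauto), if_neg (by tauto), bezoutQuot, eval_classPoly, eval_classPoly,
          Pprod_eq_zero had (Ne.symm hd), Pprod_eq_zero hbc (Ne.symm hc)]
        simp
  · rw [if_neg hab]
    have hsub : lam a - lam b ≠ 0 := sub_ne_zero.mpr (hlam.ne hab)
    have hK := bezoutQuot.sub_mul_eval (classPoly N M lam c) (classPoly N M lam d) (lam a) (lam b)
    simp only [eval_classPoly] at hK
    have hua := hu a
    have hub := hu b
    rw [eq_div_of_mul_eq hsub ((mul_comm _ _).trans hK)]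
    split_ifs with h
    · obtain ⟨rfl, rfl⟩ := h
      field_simp
    · have hz : Pprod N M lam b c * Pprod N M lam a d = 0 := by
        by_cases hcb : c = b
        · rw [Pprod_eq_zero (x := a) had fun e => h ⟨hcb, e.symm⟩, mul_zero]
        · rw [Pprod_eq_zero hbc (Ne.symm hcb), zero_mul]
      rw [hz]
      field_simp
      ring

lemma sum_rGen_mul_rGen (hM : 0 < M) (hMN : M ∣ N) (hlam : Function.Injective lam)
    (α β τ l m n : Fin N) :
    ∑ σ : Fin N, rGen N M lam l σ α β * rGen N M lam m n σ τ =
      if (l : ℕ) % M = (β : ℕ) % M ∧ (m : ℕ) % M = (τ : ℕ) % M ∧ (n : ℕ) % M = (α : ℕ) % M then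
        (bezoutQuot (bezoutQuot (classPoly N M lam α) (classPoly N M lam β) (lam l))
          (classPoly N M lam τ) (lam m)).eval (lam n)
          / (Pprod N M lam l l * Pprod N M lam m m * Pprod N M lam n n)
      else 0 := by
  simp only [rGen_eq hlam]
  split_ifs with h
  · obtain ⟨h1, h2, h3⟩ := h
    have hdeg : (bezoutQuot (classPoly N M lam α) (classPoly N M lam β) (lam l)).degree
        < (congrClass N M α).card :=
      bezoutQuot.degree_lt (degree_classPoly_lt α) ((degree_classPoly_lt β).trans_le
        (Nat.cast_le.mpr (card_congrClass_le hM hMN β α))) _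
    conv_rhs => rw [← sum_smul_classPoly hlam α hdeg]
    rw [bezoutQuot.sum_smul_left, eval_finsetSum, Finset.sum_div, congrClass, Finset.sum_filter]
    refine Finset.sum_congr rfl fun σ _ => ?_
    by_cases hσ : (σ : ℕ) % M = (α : ℕ) % M
    · rw [if_pos ⟨h1, hσ⟩, if_pos ⟨h2, h3.trans hσ.symm⟩, if_pos hσ, eval_smul, smul_eq_mul]
      simp only [div_eq_mul_inv, mul_inv]
      ring
    · rw [if_neg (by tauto), if_neg hσ, zero_mul]
  · refine Finset.sum_eq_zero fun σ _ => ?_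
    split_ifs with h1 h2
    · exact absurd ⟨h1.1, h2.1, h2.2.trans h1.2⟩ h
    all_goals simp

end

/-- For `M` a proper divisor of `N` and pairwise distinct `λ_0, …, λ_{N-1}`, the tensor
`rGen` is a skew-symmetric solution of the associative Yang–Baxter equation. -/
theorem rGen_is_AYBE_solution (N M : ℕ) (hM : 0 < M) (hMN : M ∣ N) (hlt : M < N)
    (lam : Fin N → ℂ) (hlam : Function.Injective lam) :
    IsAYBESolution N (rGen N M lam) := by
  refine ⟨fun γ ε α β => ?_, fun α β τ l m n => ?_⟩
  · rw [rGen_eq hlam, rGen_eq hlam, bezoutQuot.eval_swap]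
    split_ifs with h1 h2 h2
    · rw [mul_comm (Pprod N M lam γ γ), neg_div]
    · exact absurd h1.symm h2
    · exact absurd h2.symm h1
    · rw [neg_zero]
  · simp only [Finset.sum_add_distrib, sum_rGen_mul_rGen hM hMN hlam]
    by_cases h : (l : ℕ) % M = (β : ℕ) % M ∧ (m : ℕ) % M = (τ : ℕ) % M ∧
        (n : ℕ) % M = (α : ℕ) % M
    · rw [if_pos h, if_pos ⟨h.2.1, h.2.2, h.1⟩, if_pos ⟨h.2.2, h.1, h.2.1⟩]
      have key := bezoutQuot.cyclic_sum (classPoly N M lam α) (classPoly N M lam β)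
        (classPoly N M lam τ) (lam l) (lam m) (lam n)
      simp only [div_eq_mul_inv, mul_inv]
      linear_combination (Pprod N M lam l l)⁻¹ * (Pprod N M lam m m)⁻¹ * (Pprod N M lam n n)⁻¹ * key
    · rw [if_neg h, if_neg (by tauto), if_neg (by tauto), add_zero, add_zero]
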